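/- The graph A3 contains the wheel W_7 as an induced subgraph; consequently A3 is not 3-colourable and is not word-representable. -/

import Mathlib

/-- Two distinct letters `x` and `y` alternate in the word `w` if, after deleting all
letters other than `x` and `y` from `w`, no two consecutive letters of the resulting
word are equal (i.e. it reads `xyxy...` or `yxyx...`). -/
def Alternates {V : Type*} [DecidableEq V] (w : List V) (x y : V) : Prop :=
  List.Chain' (· ≠ ·) (w.filter fun z => z = x ∨ z = y)

/-- A finite simple graph `G = (V, E)` is word-representable if there is a word over the
alphabet `V` in which every element of `V` occurs at least once and such that, for all
distinct `x, y ∈ V`, the letters `x` and `y` alternate in the word iff `{x, y} ∈ E`. -/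
def WordRepresentable {V : Type*} [DecidableEq V] (G : SimpleGraph V) : Prop :=
  ∃ w : List V, (∀ v : V, v ∈ w) ∧
    ∀ x y : V, x ≠ y → (G.Adj x y ↔ Alternates w x y)

/-- The wheel graph `W_n` on `n + 1` vertices: a cycle on the `n` vertices `Sum.inl i`
(`i : Fin n`), together with one new hub vertex `Sum.inr ()` adjacent to all of them. -/
def wheelGraph (n : ℕ) : SimpleGraph (Fin n ⊕ Unit) :=
  SimpleGraph.fromRel fun a b =>
    match a, b with
    | Sum.inl i, Sum.inl j => ((i : ℕ) + 1) % n = (j : ℕ)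
    | Sum.inl _, Sum.inr _ => True
    | _, _ => False

/-- The simple graph on `V` whose edges are (the unordered versions of) the pairs
occurring in the list `l`. -/
def graphOfList {V : Type*} (l : List (V × V)) : SimpleGraph V :=
  SimpleGraph.fromRel fun a b => (a, b) ∈ l

def edgesA3 : List ((Fin 4 × Fin 3) × (Fin 4 × Fin 3)) :=
  [
    ((0, 0), (1, 0)), ((0, 0), (0, 1)), ((0, 1), (1, 1)), ((1, 0), (2, 0)), ((1, 1), (2, 1)),
    ((1, 1), (1, 2)), ((1, 2), (2, 2)), ((2, 0), (3, 0)), ((2, 0), (2, 1)), ((2, 1), (3, 1)),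
    ((2, 1), (2, 2)), ((2, 2), (3, 2)), ((3, 0), (3, 1)), ((3, 1), (3, 2)), ((2, 1), (3, 0)),
    ((0, 1), (1, 0)), ((0, 1), (2, 0)), ((1, 1), (2, 0)), ((1, 2), (2, 1)), ((2, 1), (3, 2))]

/-- The graph `A3` from the paper, with vertex set
`{(x,y) : 0 ≤ x ≤ 3, 0 ≤ y ≤ 2} \ {(0, 2)}`. -/
def graphA3 : SimpleGraph {p : Fin 4 × Fin 3 | p ≠ (0, 2)} :=
  (graphOfList edgesA3).induce {p : Fin 4 × Fin 3 | p ≠ (0, 2)}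

def pc {V : Type*} [DecidableEq V] (w : List V) (x : V) (n : ℕ) : ℤ := ((w.take n).count x : ℤ)

lemma pc_zero {V : Type*} [DecidableEq V] (w : List V) (x : V) : pc w x 0 = 0 := by simp [pc]

lemma pc_nil {V : Type*} [DecidableEq V] (x : V) (n : ℕ) : pc [] x n = 0 := by simp [pc]

lemma pc_succ {V : Type*} [DecidableEq V] (a : V) (w : List V) (x : V) (n : ℕ) :
    pc (a :: w) x (n + 1) = pc w x n + if a = x then 1 else 0 := by
  simp only [pc, List.take_succ_cons, List.count_cons, beq_iff_eq]
  split_ifs <;> simp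

def PP {V : Type*} [DecidableEq V] (w : List V) (x y : V) : Prop :=
  ∀ n, pc w y n ≤ pc w x n ∧ pc w x n ≤ pc w y n + 1

lemma PP_cons {V : Type*} [DecidableEq V] (a : V) (w : List V) (x y : V) :
    PP (a :: w) x y ↔ ∀ n, pc (a :: w) y (n+1) ≤ pc (a :: w) x (n+1) ∧
      pc (a :: w) x (n+1) ≤ pc (a :: w) y (n+1) + 1 := by
  constructor
  · intro h n
    exact h (n+1)
  · intro h n
    cases n with
    | zero => simp [pc_zero]
    | succ n => exact h n

lemma PP_iff {V : Type*} [DecidableEq V] (w : List V) : ∀ x y : V, x ≠ y →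
    (List.IsChain (· ≠ ·) (y :: w.filter fun z => z = x ∨ z = y) ↔ PP w x y) := by
  induction w with
  | nil => intro x y _; simp [PP, pc_nil]
  | cons a t ih =>
    intro x y hxy
    rw [PP_cons]
    simp only [pc_succ]
    by_cases hx : a = x
    · subst hx
      have h2 := ih y a hxy.symm
      have he : (t.filter fun z => z = y ∨ z = a) = t.filter fun z => z = a ∨ z = y := by
        congr 1; funext z; simp [or_comm]
      rw [he] at h2
      rw [List.filter_cons_of_pos (by simp), List.isChain_cons_cons, h2]
      simp only [hxy, if_true, if_false, PP]
      constructor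
      · rintro ⟨-, h⟩ n
        have := h n
        omega
      · intro h
        refine ⟨hxy.symm, fun n => ?_⟩
        have := h n
        omega
    · by_cases hy : a = y
      · subst hy
        rw [List.filter_cons_of_pos (by simp), List.isChain_cons_cons]
        constructor
        · rintro ⟨h, -⟩
          exact absurd rfl h
        · intro h
          have := h 0
          simp [pc_zero, hx] at this
      · rw [List.filter_cons_of_neg (by simp [hx, hy]), ih x y hxy]
        simp [hx, hy, PP]

lemma alt_iff {V : Type*} [DecidableEq V] (w : List V) (x y : V) (hxy : x ≠ y) :
    Alternates w x y ↔ PP w x y ∨ PP w y x := by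
  have h1 := PP_iff w x y hxy
  have h2 := PP_iff w y x hxy.symm
  have he : (w.filter fun z => z = y ∨ z = x) = w.filter fun z => z = x ∨ z = y := by
    congr 1; funext z; simp [or_comm]
  rw [he] at h2
  rw [← h1, ← h2]
  change List.IsChain _ _ ↔ _
  have hm : ∀ z ∈ (w.filter fun z => z = x ∨ z = y), z = x ∨ z = y := by
    intro z hz
    simpa using (List.mem_filter.1 hz).2
  generalize (w.filter fun z => z = x ∨ z = y) = l at hm
  cases l with
  | nil => simp
  | cons b l =>
    rw [List.isChain_cons_cons, List.isChain_cons_cons]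
    rcases hm b (by simp) with rfl | rfl
    · simp [hxy.symm]
    · simp [hxy]

/-- The neighbourhood of a vertex of a word-representable graph is a comparability graph. -/
lemma nbhd_comparability {V : Type*} [DecidableEq V] (G : SimpleGraph V)
    (hG : WordRepresentable G) (h : V) :
    ∃ f : V → ℕ → ℤ, ∀ x y, G.Adj x h → G.Adj y h → x ≠ y →
      (G.Adj x y ↔ f x ≤ f y ∨ f y ≤ f x) := by
  classical
  obtain ⟨w, -, hw⟩ := hG
  have key : ∀ x y, x ≠ y → (G.Adj x y ↔ PP w x y ∨ PP w y x) := fun x y hxy =>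
    (hw x y hxy).trans (alt_iff w x y hxy)
  refine ⟨fun x n => pc w x n - pc w h n + if PP w x h then 0 else 1, ?_⟩
  intro x y hx hy hxy
  have ax := (key x h hx.ne).1 hx
  have ay := (key y h hy.ne).1 hy
  rw [key x y hxy]
  simp only [Pi.le_def]
  by_cases px : PP w x h <;> by_cases py : PP w y h <;> simp only [px, py, if_true, if_false]
  · constructor
    · rintro (a | a)
      · right; intro n; have := a n; omega
      · left; intro n; have := a n; omega
    · rintro (a | a)
      · right; intro n; have := a n; have := px n; have := py n; omega
      · left; intro n; have := a n; have := px n; have := py n; omega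
  · have qy := ay.resolve_left py
    constructor
    · rintro (a | a)
      · left; intro n; have := a n; omega
      · left; intro n; have := a n; omega
    · rintro (a | a)
      · left; intro n; have := a n; have := px n; have := qy n; omega
      · have := a 0; simp [pc_zero] at this
  · have qx := ax.resolve_left px
    constructor
    · rintro (a | a)
      · right; intro n; have := a n; omega
      · right; intro n; have := a n; omega
    · rintro (a | a)
      · have := a 0; simp [pc_zero] at this
      · right; intro n; have := a n; have := qx n; have := py n; omega
  · have qy := ay.resolve_left py
    have qx := ax.resolve_left px
    constructor
    · rintro (a | a)
      · right; intro n; have := a n; omega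
      · left; intro n; have := a n; omega
    · rintro (a | a)
      · right; intro n; have := a n; have := qx n; have := qy n; omega
      · left; intro n; have := a n; have := qx n; have := qy n; omega

def rimA3 : Fin 7 → {p : Fin 4 × Fin 3 | p ≠ (0, 2)} :=
  ![⟨(1,1), by simp⟩, ⟨(2,0), by simp⟩, ⟨(3,0), by simp⟩, ⟨(3,1), by simp⟩,
    ⟨(3,2), by simp⟩, ⟨(2,2), by simp⟩, ⟨(1,2), by simp⟩]

def wheelMap : Fin 7 ⊕ Unit → {p : Fin 4 × Fin 3 | p ≠ (0, 2)}
  | Sum.inl i => rimA3 i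
  | Sum.inr _ => ⟨(2,1), by simp⟩

instance decA3 : DecidableRel graphA3.Adj := fun a b =>
  inferInstanceAs (Decidable (a.1 ≠ b.1 ∧ ((a.1, b.1) ∈ edgesA3 ∨ (b.1, a.1) ∈ edgesA3)))

lemma rim_inj : ∀ i j, wheelMap i = wheelMap j → i = j := by decide

lemma rim_adj : ∀ i j : Fin 7, graphA3.Adj (rimA3 i) (rimA3 j) ↔ (j = i + 1 ∨ i = j + 1) := by
  decide

lemma hub_adj : ∀ i : Fin 7, graphA3.Adj (rimA3 i) (wheelMap (Sum.inr ())) := by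
  decide

lemma wheel_adj : ∀ i j : Fin 7, (wheelGraph 7).Adj (Sum.inl i) (Sum.inl j) ↔
    (j = i + 1 ∨ i = j + 1) := by
  intro i j
  simp only [wheelGraph, SimpleGraph.fromRel_adj]
  revert i j
  decide

def wheelEmb : wheelGraph 7 ↪g graphA3 where
  toFun := wheelMap
  inj' := fun i j h => rim_inj i j h
  map_rel_iff' := by
    intro a b
    rcases a with i | ⟨⟩ <;> rcases b with j | ⟨⟩
    · exact (rim_adj i j).trans (wheel_adj i j).symm
    · exact iff_of_true (hub_adj i) (by simp [wheelGraph])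
    · exact iff_of_true (hub_adj j).symm (by simp [wheelGraph])
    · exact iff_of_false (SimpleGraph.irrefl _) (SimpleGraph.irrefl _)

lemma three_step : ∀ h a b c : Fin 3, a ≠ h → b ≠ h → c ≠ h → a ≠ b → b ≠ c → a = c := by
  intros
  omega

lemma not_col : ¬ graphA3.Colorable 3 := by
  rintro ⟨C⟩
  have hh : ∀ i, C (rimA3 i) ≠ C (wheelMap (Sum.inr ())) := fun i => C.valid (hub_adj i)
  have hr : ∀ i, C (rimA3 i) ≠ C (rimA3 (i + 1)) := fun i =>
    C.valid ((rim_adj _ _).2 (Or.inl rfl))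
  have st : ∀ i, C (rimA3 i) = C (rimA3 (i + 1 + 1)) := fun i =>
    three_step _ _ _ _ (hh _) (hh _) (hh _) (hr _) (hr _)
  exact hr 6 (((st 0).trans ((st 2).trans (st 4))).symm)

lemma not_wr : ¬ WordRepresentable graphA3 := by
  intro hG
  obtain ⟨f, hf⟩ := nbhd_comparability _ hG (wheelMap (Sum.inr ()))
  have ne : ∀ i j, i ≠ j → rimA3 i ≠ rimA3 j := fun i j hij h =>
    hij (Sum.inl_injective (rim_inj (Sum.inl i) (Sum.inl j) h))
  have k : ∀ i j, i ≠ j → ((j = i + 1 ∨ i = j + 1) ↔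
      f (rimA3 i) ≤ f (rimA3 j) ∨ f (rimA3 j) ≤ f (rimA3 i)) := fun i j hij =>
    (rim_adj i j).symm.trans (hf _ _ (hub_adj i) (hub_adj j) (ne i j hij))
  generalize hg : (fun i => f (rimA3 i)) = g
  have k : ∀ i j, i ≠ j → ((j = i + 1 ∨ i = j + 1) ↔ g i ≤ g j ∨ g j ≤ g i) := by
    subst hg; exact k
  have n1 : ∀ i : Fin 7, i ≠ i + 1 := by decide
  have n2 : ∀ i : Fin 7, i ≠ i + 1 + 1 := by decide
  have n3 : ∀ i : Fin 7, ¬ (i + 1 + 1 = i + 1 ∨ i = i + 1 + 1 + 1) := by decide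
  have e : ∀ i, g i ≤ g (i+1) ∨ g (i+1) ≤ g i := fun i => (k i (i+1) (n1 i)).1 (Or.inl rfl)
  have ne2 : ∀ i, ¬ (g i ≤ g (i+1+1) ∨ g (i+1+1) ≤ g i) := fun i h =>
    n3 i ((k i (i+1+1) (n2 i)).2 h)
  have up : ∀ i, g i ≤ g (i+1) → g (i+1+1) ≤ g (i+1) := fun i h =>
    (e (i+1)).resolve_left fun h' => ne2 i (Or.inl (h.trans h'))
  have dn : ∀ i, g (i+1) ≤ g i → g (i+1) ≤ g (i+1+1) := fun i h =>
    (e (i+1)).resolve_right fun h' => ne2 i (Or.inr (h'.trans h))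
  rcases e 0 with h | h
  · exact ne2 6 (Or.inl ((dn 5 (up 4 (dn 3 (up 2 (dn 1 (up 0 h)))))).trans h))
  · exact ne2 6 (Or.inr (h.trans (up 5 (dn 4 (up 3 (dn 2 (up 1 (dn 0 h))))))))

/-- The graph `A3` contains the wheel `W_7` as an induced subgraph; consequently `A3`
is not 3-colourable and is not word-representable. -/
theorem graphA3_wheel7_not_colorable_not_wordRepresentable :
    Nonempty (wheelGraph 7 ↪g graphA3) ∧
      ¬ graphA3.Colorable 3 ∧ ¬ WordRepresentable graphA3 := 
  ⟨⟨wheelEmb⟩, not_col, not_wr⟩
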